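/- arXiv:1206.2691 — 6 statements merged into one kernel-verified Lean document; each statement's English description precedes it below -/
import Mathlib

section
/- Let A be a DFA, V ⊆ Σ*, α, β ∈ Σ* and b ∈ Σ. If E_V(α) = E_V(β) and γ ∈ E_V(αb) ⊕ E_V(βb), then bγ ∉ V. (Hence every distinguishing string added by a partition-refinement step of the ID/IDS algorithms is distinct from all previously added distinguishing strings.) -/
/-- The row of a string `x` with respect to a set `V` of distinguishing strings:
`E_V(x) = {v ∈ V : x ++ v ∈ L(A)}`. -/
def row {α σ : Type*} (A : DFA α σ) (V : Set (List α)) (x : List α) : Set (List α) :=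
  {v ∈ V | x ++ v ∈ A.accepts}

/-- If `E_V(α) = E_V(β)` and `γ ∈ E_V(αb) ⊕ E_V(βb)`, then `bγ ∉ V`: each distinguishing
string added by a partition-refinement step is new. -/
theorem new_distinguishing_string_not_mem {α σ : Type*} [Fintype α] [Fintype σ]
    (A : DFA α σ) (V : Set (List α)) (a c : List α) (b : α) (γ : List α)
    (h1 : row A V a = row A V c)
    (hγ : γ ∈ (row A V (a ++ [b]) \ row A V (c ++ [b])) ∪
              (row A V (c ++ [b]) \ row A V (a ++ [b]))) :
    (b :: γ) ∉ V := by
  intro hb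
  have h : b :: γ ∈ row A V a ↔ b :: γ ∈ row A V c := by rw [h1]
  simp only [row, Set.mem_union, Set.mem_sdiff, Set.mem_ofPred_eq, List.append_assoc,
    List.singleton_append] at h hγ
  tauto
end

section
/- Let A be a DFA, V ⊆ Σ*, T ⊆ Σ* a finite set, α, β ∈ T, and b ∈ Σ with αb, βb ∈ Σ*. Suppose E_V(α) = E_V(β) but E_V(αb) ≠ E_V(βb), let γ ∈ E_V(αb) ⊕ E_V(βb) and set V' = V ∪ {bγ}. Then the number of distinct rows |{E_{V'}(τ) : τ ∈ T}| is strictly greater than |{E_V(τ) : τ ∈ T}|; that is, each partition-refinement step of the ID/IDS algorithms strictly increases the number of partition classes on T. -/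
theorem inter_row_union {α σ : Type*} (A : DFA α σ) (V W : Set (List α)) (x : List α) :
    V ∩ row A (V ∪ W) x = row A V x := by
  ext v
  simp only [row, Set.mem_inter_iff, Set.mem_ofPred_eq, Set.mem_union]
  tauto

theorem image_inter_image_row {α σ : Type*} (A : DFA α σ) (V W T : Set (List α)) :
    (V ∩ ·) '' (row A (V ∪ W) '' T) = row A V '' T := by
  simp only [Set.image_image, inter_row_union]

/-- A partition-refinement step strictly increases the number of partition classes on `T`:
if `α, β ∈ T` have equal `V`-rows but `E_V(αb) ≠ E_V(βb)`, and `γ ∈ E_V(αb) ⊕ E_V(βb)`,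
then the number of distinct rows of elements of `T` with respect to `V' = V ∪ {bγ}` is
strictly greater than with respect to `V`. -/
theorem refinement_step_increases_classes {α σ : Type*} [Fintype α] [Fintype σ]
    (A : DFA α σ) (V T : Set (List α)) (hT : T.Finite)
    (a c : List α) (ha : a ∈ T) (hc : c ∈ T) (b : α)
    (h1 : row A V a = row A V c)
    (h2 : row A V (a ++ [b]) ≠ row A V (c ++ [b]))
    (γ : List α)
    (hγ : γ ∈ (row A V (a ++ [b]) \ row A V (c ++ [b])) ∪
              (row A V (c ++ [b]) \ row A V (a ++ [b]))) :
    (row A V '' T).ncard < (row A (V ∪ {b :: γ}) '' T).ncard := by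
  have hfin : (row A (V ∪ {b :: γ}) '' T).Finite := hT.image _
  rw [← image_inter_image_row A V {b :: γ} T]
  refine lt_of_le_of_ne (Set.ncard_image_le hfin) fun h => ?_
  have hinj := (Set.ncard_image_iff hfin).mp h
  have hrow : row A (V ∪ {b :: γ}) a = row A (V ∪ {b :: γ}) c :=
    hinj (Set.mem_image_of_mem _ ha) (Set.mem_image_of_mem _ hc) (by
      simpa only [inter_row_union] using h1)
  have hmem : a ++ b :: γ ∈ A.accepts ↔ c ++ b :: γ ∈ A.accepts := by
    simpa [row] using Set.ext_iff.mp hrow (b :: γ)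
  simp only [row, Set.mem_union, Set.mem_sdiff, Set.mem_ofPred_eq, List.append_assoc,
    List.singleton_append] at hγ
  tauto
end

section
/- Let A be a DFA and P ⊆ Σ* a live complete set for A. Then for every V ⊆ Σ* and every α ∈ Σ*, either E_V(α) = ∅ or there exists β ∈ P with E_V(β) = E_V(α). (Every row of an arbitrary string is either the empty row or already occurs as the row of a string in the live complete set.) -/
/-- A state is live if some string leads from it to an accepting state. -/
def Live {α σ : Type*} (A : DFA α σ) (q : σ) : Prop :=
  ∃ w : List α, A.evalFrom q w ∈ A.accept

/-- A finite set `P` of strings is live complete for `A` if every live state is reached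
from the initial state by some string of `P`. -/
def LiveComplete {α σ : Type*} (A : DFA α σ) (P : Set (List α)) : Prop :=
  P.Finite ∧ ∀ q : σ, Live A q → ∃ a ∈ P, A.eval a = q

theorem mem_accepts_append {α σ : Type*} (A : DFA α σ) {x v : List α} :
    x ++ v ∈ A.accepts ↔ A.evalFrom (A.eval x) v ∈ A.accept := by
  rw [DFA.mem_accepts, DFA.eval, DFA.evalFrom_of_append, ← DFA.eval]

/-- Strings leading to the same state have the same row. -/
theorem row_eq_of_eval_eq {α σ : Type*} {A : DFA α σ} (V : Set (List α)) {x y : List α}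
    (h : A.eval x = A.eval y) : row A V x = row A V y := by
  simp only [row, mem_accepts_append, h]

/-- If `P` is live complete for `A` then every row is either the empty row or equal to the
row of some string in `P`. -/
theorem row_empty_or_realized_in_liveComplete {α σ : Type*} [Fintype α] [Fintype σ]
    (A : DFA α σ) (P : Set (List α)) (hP : LiveComplete A P) :
    ∀ (V : Set (List α)) (x : List α),
      row A V x = ∅ ∨ ∃ β ∈ P, row A V β = row A V x := by
  intro V x
  refine (row A V x).eq_empty_or_nonempty.imp_right ?_
  rintro ⟨v, -, hv⟩
  obtain ⟨β, hβ, h⟩ := hP.2 (A.eval x) ⟨v, (mem_accepts_append A).1 hv⟩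
  exact ⟨β, hβ, row_eq_of_eval_eq V h⟩
end

section
/- Let A be a DFA, P ⊆ Σ* a live complete set for A with λ ∈ P, and V ⊆ Σ* with λ ∈ V such that V is closed for P. Then for every α ∈ P: E_V(α) = ∅ if and only if δ*(q0, α) is a dead state, equivalently if and only if αw ∉ L(A) for every w ∈ Σ*. -/
/-- `V` is closed for `P`: (a) equal rows of members of `P` remain equal after any
one-symbol extension, and (b) empty rows of members of `P` remain empty after any
one-symbol extension. -/
def ClosedFor {α σ : Type*} (A : DFA α σ) (V P : Set (List α)) : Prop :=
  (∀ a ∈ P, ∀ c ∈ P, ∀ b : α,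
      row A V a = row A V c → row A V (a ++ [b]) = row A V (c ++ [b])) ∧
  (∀ a ∈ P, ∀ b : α, row A V a = ∅ → row A V (a ++ [b]) = ∅)

/-- No extension of a string of `P` with an empty row is accepted. -/
theorem append_notMem_accepts_of_row_eq_empty {α σ : Type*} {A : DFA α σ}
    {P V : Set (List α)} (hP : LiveComplete A P) (hnilV : ([] : List α) ∈ V)
    (hcl : ClosedFor A V P) {a : List α} (ha : a ∈ P) (hrow : row A V a = ∅)
    (w : List α) : a ++ w ∉ A.accepts := by
  induction w generalizing a with
  | nil => exact fun h => Set.eq_empty_iff_forall_notMem.mp hrow [] ⟨hnilV, h⟩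
  | cons b w ih =>
    intro h
    rw [List.append_cons, DFA.mem_accepts, DFA.eval, DFA.evalFrom_of_append] at h
    obtain ⟨c, hc, hce⟩ := hP.2 (A.eval (a ++ [b])) ⟨w, h⟩
    refine ih hc ((row_eq_of_eval_eq V hce).trans (hcl.2 a ha b hrow)) ?_
    rw [DFA.mem_accepts, DFA.eval, DFA.evalFrom_of_append]
    change A.evalFrom (A.eval c) w ∈ A.accept
    rw [hce]
    exact h

/-- A string reaches a dead state iff none of its extensions is accepted. -/
theorem not_live_eval_iff {α σ : Type*} (A : DFA α σ) (a : List α) :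
    ¬ Live A (A.eval a) ↔ ∀ w : List α, a ++ w ∉ A.accepts := by
  simp only [Live, not_exists, DFA.mem_accepts, DFA.eval, DFA.evalFrom_of_append]

/-- If `P` is live complete with `λ ∈ P`, `λ ∈ V` and `V` is closed for `P`, then for
`α ∈ P` the row `E_V(α)` is empty iff `δ*(q0, α)` is dead, equivalently iff no extension
`αw` is accepted. -/
theorem row_empty_iff_dead {α σ : Type*} [Fintype α] [Fintype σ]
    (A : DFA α σ) (P V : Set (List α)) (hP : LiveComplete A P)
    (hnilP : ([] : List α) ∈ P) (hnilV : ([] : List α) ∈ V) (hcl : ClosedFor A V P) :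
    ∀ a ∈ P,
      (row A V a = ∅ ↔ ¬ Live A (A.eval a)) ∧
      (row A V a = ∅ ↔ ∀ w : List α, a ++ w ∉ A.accepts) := by
  intro a ha
  have key : row A V a = ∅ ↔ ∀ w : List α, a ++ w ∉ A.accepts :=
    ⟨append_notMem_accepts_of_row_eq_empty hP hnilV hcl ha,
      fun h => Set.eq_empty_iff_forall_notMem.mpr fun v hv => h v hv.2⟩
  exact ⟨key.trans (not_live_eval_iff A a).symm, key⟩
end

section
/- Let A be a DFA, P ⊆ Σ* a live complete set for A with λ ∈ P, and V ⊆ Σ* with λ ∈ V such that V is closed for P. Then for all α, β ∈ Σ* (not only in P): E_V(α) = E_V(β) if and only if α and β are Nerode-equivalent with respect to L(A). In particular, the map sending the Nerode class of α to E_V(α) is a well-defined bijection between the Nerode classes of L(A) realized by strings in Σ* and the set of rows {E_V(α) : α ∈ Σ*}. -/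
lemma append_mem_accepts_iff {α σ : Type*} (A : DFA α σ) (x w : List α) :
    x ++ w ∈ A.accepts ↔ A.evalFrom (A.eval x) w ∈ A.accept := by
  simp only [DFA.mem_accepts, DFA.eval, DFA.evalFrom_of_append]

lemma row_append_congr {α σ : Type*} (A : DFA α σ) (V : Set (List α)) {x y : List α}
    (h : A.eval x = A.eval y) (z : List α) : row A V (x ++ z) = row A V (y ++ z) := by
  ext v
  simp only [row, Set.mem_ofPred_eq, List.append_assoc, append_mem_accepts_iff, h]

lemma row_append_eq_empty_of_not_live {α σ : Type*} (A : DFA α σ) (V : Set (List α))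
    {x : List α} (h : ¬ Live A (A.eval x)) (z : List α) : row A V (x ++ z) = ∅ := by
  refine Set.eq_empty_of_forall_notMem fun v hv => h ⟨z ++ v, ?_⟩
  rw [← append_mem_accepts_iff, ← List.append_assoc]
  exact hv.2

lemma row_append_singleton_eq_empty {α σ : Type*} {A : DFA α σ} {P V : Set (List α)}
    (hP : LiveComplete A P) (hcl : ClosedFor A V P) {x : List α} (h : row A V x = ∅) (b : α) :
    row A V (x ++ [b]) = ∅ := by
  by_cases hx : Live A (A.eval x)
  · obtain ⟨p, hp, hpx⟩ := hP.2 _ hx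
    rw [← row_append_congr A V hpx]
    refine hcl.2 p hp b ?_
    simpa [h] using row_append_congr A V hpx []
  · exact row_append_eq_empty_of_not_live A V hx [b]

lemma row_append_singleton_congr {α σ : Type*} {A : DFA α σ} {P V : Set (List α)}
    (hP : LiveComplete A P) (hcl : ClosedFor A V P) {x y : List α}
    (h : row A V x = row A V y) (b : α) : row A V (x ++ [b]) = row A V (y ++ [b]) := by
  by_cases hxy : row A V x = ∅
  · rw [row_append_singleton_eq_empty hP hcl hxy,
      row_append_singleton_eq_empty hP hcl (h ▸ hxy)]
  · have live_of_row_ne_empty : ∀ z, row A V z ≠ ∅ → Live A (A.eval z) := fun z hz => by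
      by_contra hl
      exact hz (by simpa using row_append_eq_empty_of_not_live A V hl [])
    obtain ⟨p, hp, hpx⟩ := hP.2 _ (live_of_row_ne_empty x hxy)
    obtain ⟨q, hq, hqy⟩ := hP.2 _ (live_of_row_ne_empty y (h ▸ hxy))
    rw [← row_append_congr A V hpx, ← row_append_congr A V hqy]
    refine hcl.1 p hp q hq b ?_
    have hp' : row A V p = row A V x := by simpa using row_append_congr A V hpx []
    have hq' : row A V q = row A V y := by simpa using row_append_congr A V hqy []
    rw [hp', hq', h]

lemma append_mem_accepts_iff_of_row_eq {α σ : Type*} {A : DFA α σ} {P V : Set (List α)}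
    (hP : LiveComplete A P) (hnilV : [] ∈ V) (hcl : ClosedFor A V P) {x y : List α}
    (h : row A V x = row A V y) (w : List α) : x ++ w ∈ A.accepts ↔ y ++ w ∈ A.accepts := by
  induction w generalizing x y with
  | nil => simpa [row, hnilV] using Set.ext_iff.mp h []
  | cons b w ih => simpa using ih (row_append_singleton_congr hP hcl h b)

/-- Equality of rows coincides with Nerode equivalence for *all* strings (not only those
in `P`); in particular the map sending the Nerode class of `α` to `E_V(α)` is a
well-defined bijection onto the set of rows. -/
theorem row_eq_iff_nerode {α σ : Type*} [Fintype α] [Fintype σ]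
    (A : DFA α σ) (P V : Set (List α)) (hP : LiveComplete A P)
    (hnilP : ([] : List α) ∈ P) (hnilV : ([] : List α) ∈ V) (hcl : ClosedFor A V P) :
    (∀ a c : List α,
      (row A V a = row A V c ↔
        ∀ w : List α, a ++ w ∈ A.accepts ↔ c ++ w ∈ A.accepts)) ∧
    (∀ (s : Setoid (List α)),
      (∀ a c : List α, s.r a c ↔ ∀ w : List α, a ++ w ∈ A.accepts ↔ c ++ w ∈ A.accepts) →
      ∀ f : Quotient s → Set (List α),
        (∀ a : List α, f ⟦a⟧ = row A V a) →
        Function.Injective f ∧ Set.range f = Set.range (row A V)) := by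
  have key : ∀ a c : List α, row A V a = row A V c ↔
      ∀ w : List α, a ++ w ∈ A.accepts ↔ c ++ w ∈ A.accepts := fun a c =>
    ⟨append_mem_accepts_iff_of_row_eq hP hnilV hcl, fun h => by simp only [row, h]⟩
  refine ⟨key, fun s hs f hf => ⟨?_, ?_⟩⟩
  · rintro ⟨a⟩ ⟨c⟩ h
    exact Quotient.sound ((hs a c).2 ((key a c).1 ((hf a).symm.trans (h.trans (hf c)))))
  · rw [← Quotient.mk_surjective.range_comp f]
    exact congrArg Set.range (funext hf)
end

section
/- Let A be a DFA, P ⊆ Σ* a finite prefix-closed set (not assumed live complete) with λ ∈ P, and V ⊆ Σ* with λ ∈ V such that V is closed for P, and let rep be any representative function for (V, P). Then for every string α all of whose prefixes lie in P, the state reached by the hypothesis DFA M = M(A, V, P, rep) from its start state E_V(λ) on input α equals E_V(α). -/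
/-- `rep` is a representative function for `(V, P)`: it assigns to each nonempty row of a
string of `P` a string of `P` having that row. -/
def IsRepFun {α σ : Type*} (A : DFA α σ) (V P : Set (List α))
    (rep : Set (List α) → List α) : Prop :=
  ∀ r : Set (List α), (∃ a ∈ P, row A V a = r) → r ≠ ∅ →
    rep r ∈ P ∧ row A V (rep r) = r

open Classical in
/-- The transition function of the hypothesis DFA: on a nonempty row of a string of `P`,
step via a representative; on all other state names, go to the empty (dead) state. -/
noncomputable def hypStep {α σ : Type*} (A : DFA α σ) (V P : Set (List α))
    (rep : Set (List α) → List α) (r : Set (List α)) (b : α) : Set (List α) :=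
  if (∃ a ∈ P, row A V a = r) ∧ r ≠ ∅ then row A V (rep r ++ [b]) else ∅

/-- The hypothesis DFA `M(A, V, P, rep)`: states are subsets of `Σ*`, the start state is
`E_V(λ)`, accepting states are the rows containing `λ`, and transitions are `hypStep`. -/
noncomputable def hypDFA {α σ : Type*} (A : DFA α σ) (V P : Set (List α))
    (rep : Set (List α) → List α) : DFA α (Set (List α)) where
  step := hypStep A V P rep
  start := row A V []
  accept := {r : Set (List α) | [] ∈ r}

/-- A set of strings is prefix-closed if it contains every prefix of each of its members. -/
def PrefixClosed {α : Type*} (P : Set (List α)) : Prop :=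
  ∀ x ∈ P, ∀ p : List α, p <+: x → p ∈ P

/-- The hypothesis DFA steps from the row of a member of `P` to the row of its extension. -/
theorem hypStep_row {α σ : Type*} {A : DFA α σ} {V P : Set (List α)}
    {rep : Set (List α) → List α} (hcl : ClosedFor A V P) (hrep : IsRepFun A V P rep)
    {a : List α} (ha : a ∈ P) (b : α) :
    hypStep A V P rep (row A V a) b = row A V (a ++ [b]) := by
  have hrow : ∃ c ∈ P, row A V c = row A V a := ⟨a, ha, rfl⟩
  by_cases hne : row A V a = ∅
  · rw [hypStep, if_neg fun h => h.2 hne, hcl.2 a ha b hne]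
  · obtain ⟨hmem, heq⟩ := hrep _ hrow hne
    rw [hypStep, if_pos ⟨hrow, hne⟩]
    exact hcl.1 _ hmem a ha b heq

/-- For a finite prefix-closed observation set `P` (not assumed live complete), the run of
the hypothesis DFA computes rows of every string all of whose prefixes lie in `P`. -/
theorem hypDFA_eval_eq_row_of_prefixes_mem {α σ : Type*} [Fintype α] [Fintype σ]
    (A : DFA α σ) (V P : Set (List α)) (hPfin : P.Finite) (hpc : PrefixClosed P)
    (hnilP : ([] : List α) ∈ P) (hnilV : ([] : List α) ∈ V) (hcl : ClosedFor A V P)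
    (rep : Set (List α) → List α) (hrep : IsRepFun A V P rep) :
    ∀ x : List α, (∀ p : List α, p <+: x → p ∈ P) →
      (hypDFA A V P rep).eval x = row A V x := by
  intro x
  induction x using List.reverseRecOn with
  | nil => exact fun _ => rfl
  | append_singleton x b ih =>
    intro h
    rw [DFA.eval_append_singleton, ih fun p hp => h p (hp.trans (List.prefix_append x [b]))]
    exact hypStep_row hcl hrep (h x (List.prefix_append x [b])) b
end
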